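/- Let F be a field of characteristic p > 0 and let S_1, ..., S_{r+1} ⊆ F be nonempty sets with pdeg(S_i) = 1 for i = 1, ..., r and dS_1 ∧ ... ∧ dS_r ∧ dS_{r+1} ≠ {0}. Write pdeg(S_1 ∪ ... ∪ S_r ∪ S_{r+1}) = r + ℓ with ℓ ∈ ℤ. Then ℓ ≥ 1, and for any p-independent elements a_1, ..., a_r, e_1, ..., e_ℓ ∈ F with F^p(S_i) = F^p(a_i) for i = 1, ..., r and F^p(a_1, ..., a_r)(S_{r+1}) = F^p(a_1, ..., a_r)(e_1, ..., e_ℓ), one has annΩ^n_F(dS_1 ∧ ... ∧ dS_r ∧ dS_{r+1}) = Σ_{i=1}^r d a_i ∧ Ω^{n−1}(F) + d e_1 ∧ ... ∧ d e_ℓ ∧ Ω^{n−ℓ}(F). -/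

import Mathlib

set_option synthInstance.maxHeartbeats 1000000
set_option maxHeartbeats 1000000

open ExteriorAlgebra

noncomputable section Preamble

variable (F : Type) [Field F] (p : ℕ)

/-- The subfield `F^{p^t}(C)` of `F` generated by the `p^t`-th powers and the set `C`. -/
def pClosureT (t : ℕ) (C : Set F) : Subfield F :=
  Subfield.closure ((Set.range fun x : F => x ^ p ^ t) ∪ C)

/-- The subfield `F^p(C)` of `F` generated by the `p`-th powers and the set `C`. -/
def pClosure (C : Set F) : Subfield F := pClosureT F p 1 C

/-- The degree `[B(A) : B]` for a subfield `B` of `F` and a subset `A ⊆ F`. -/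
def relDeg (B : Subfield F) (A : Set F) : ℕ :=
  Module.finrank B (IntermediateField.adjoin B A)

/-- `pdeg A = k`, i.e. `[F^p(A) : F^p] = p ^ k`. -/
def pDegEq (A : Set F) (k : ℕ) : Prop :=
  relDeg F (pClosure F p ∅) A = p ^ k

/-- A finite family `a : Fin n → F` is `p`-independent if `[F^p(a₁,…,aₙ) : F^p] = pⁿ`. -/
def pIndep {n : ℕ} (a : Fin n → F) : Prop :=
  pDegEq F p (Set.range a) n

/-- The exterior algebra of the absolute differential forms of `F`; the spaces `Ωⁿ(F)`
are its graded pieces and the wedge product is its multiplication. -/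
abbrev ExtOmega := ExteriorAlgebra F (Ω[F⁄ℤ])

/-- The differential `d a` of an element `a : F`, viewed in the exterior algebra. -/
def dform (a : F) : ExtOmega F :=
  ExteriorAlgebra.ι F (KaehlerDifferential.D ℤ F a)

/-- The space `Ωⁿ(F)` of `n`-differential forms, as a submodule of the exterior algebra;
it is `0` for `n < 0`. -/
def OmegaPow (n : ℤ) : Submodule F (ExtOmega F) :=
  if 0 ≤ n then ⋀[F]^(n.toNat) (Ω[F⁄ℤ]) else ⊥

/-- The wedge product `d a₁ ∧ … ∧ d aₙ` of the differentials of a family. -/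
def dwedge {n : ℕ} (a : Fin n → F) : ExtOmega F :=
  (List.ofFn fun i => dform F (a i)).prod

/-- The annihilator `annΩ^n_F(U)` of a set `U` of differential forms. -/
def annOmega (n : ℕ) (U : Set (ExtOmega F)) : Submodule F (ExtOmega F) :=
  OmegaPow F n ⊓ ⨅ u ∈ U, LinearMap.ker (LinearMap.mulRight F u)

/-- The logarithmic differential form `(dx₁/x₁) ∧ … ∧ (dxₙ/xₙ)`. -/
def logForm {n : ℕ} (x : Fin n → F) : ExtOmega F :=
  (List.ofFn fun i => ExteriorAlgebra.ι F ((x i)⁻¹ • KaehlerDifferential.D ℤ F (x i))).prod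

/-- The group `ν_n(F)`, additively generated by the logarithmic differential forms;
it is `0` for `n < 0`. -/
def nuPow (n : ℤ) : AddSubgroup (ExtOmega F) :=
  if 0 ≤ n then
    AddSubgroup.closure
      {ω | ∃ x : Fin n.toNat → F, (∀ i, x i ≠ 0) ∧ ω = logForm F x}
  else ⊥

/-- The annihilator `ann ν^n_F(U)`. -/
def annNu (n : ℕ) (U : Set (ExtOmega F)) : AddSubgroup (ExtOmega F) :=
  (annOmega F n U).toAddSubgroup ⊓ nuPow F n

/-- `η ∧ W` for a form `η` and a subspace `W`. -/
def wedgeL (η : ExtOmega F) (W : Submodule F (ExtOmega F)) : Submodule F (ExtOmega F) :=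
  W.map (LinearMap.mulLeft F η)

/-- The set `dS₁ ∧ … ∧ dSᵣ` for sets `S₁, …, Sᵣ ⊆ F`. -/
def dSet {r : ℕ} (S : Fin r → Set F) : Set (ExtOmega F) :=
  {ω | ∃ s : Fin r → F, (∀ i, s i ∈ S i) ∧ ω = dwedge F s}

/-- The additive subgroup `[dy₁/y₁ ∧ … ∧ dy_t/y_t ∣ yᵢ ∈ K^*] ∧ ν_m(F)` of `Ωⁿ(F)`
(for `n = t + m`). -/
def logWedgeNu (K : Set F) (t : ℕ) (m : ℤ) : AddSubgroup (ExtOmega F) :=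
  AddSubgroup.closure
    {ω | ∃ y : Fin t → F, (∀ i, y i ∈ K ∧ y i ≠ 0) ∧
      ∃ χ ∈ nuPow F m, ω = logForm F y * χ}

variable (E : Type) [Field E] [Algebra F E]

/-- The restriction map `Ω(F) → Ω(E)` on exterior algebras of differential forms,
induced by the inclusion `F ⊆ E`; it sends `d a` to `d a` and `x dа₁ ∧ … ∧ daₙ` to
the corresponding form over `E`. -/
def resMap : ExtOmega F →+* ExtOmega E :=
  letI : Algebra F (ExtOmega E) :=
    ((algebraMap E (ExtOmega E)).comp (algebraMap F E)).toAlgebra'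
      (fun c x => Algebra.commutes (algebraMap F E c) x)
  (ExteriorAlgebra.lift F ⟨{
      toFun := fun w =>
        ExteriorAlgebra.ι E (KaehlerDifferential.map ℤ ℤ F E w)
      map_add' := fun x y => by simp
      map_smul' := fun c x => by
        simp only [map_smul, RingHom.id_apply]
        rw [← algebraMap_smul E c (KaehlerDifferential.map ℤ ℤ F E x), map_smul,
          Algebra.smul_def, Algebra.smul_def]
        rfl },
    fun m => ExteriorAlgebra.ι_sq_zero _⟩).toRingHom

/-- The kernel `Ωⁿ(E/F)` of the restriction map `Ωⁿ(F) → Ωⁿ(E)`. -/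
def OmegaKer (n : ℕ) : Set (ExtOmega F) :=
  {ω | ω ∈ OmegaPow F n ∧ resMap F E ω = 0}

/-- The kernel `ν_n(E/F) = Ωⁿ(E/F) ∩ ν_n(F)`. -/
def nuKer (n : ℕ) : Set (ExtOmega F) :=
  OmegaKer F E n ∩ (nuPow F n : Set (ExtOmega F))

end Preamble

section PurelyInseparableExponentOne

open IntermediateField

variable {K F : Type*} [Field K] [Field F] [Algebra K F] {p : ℕ}

lemma isIntegral_of_pow_mem_range (hp : p.Prime) {x : F}
    (hx : x ^ p ∈ (algebraMap K F).range) : IsIntegral K x := by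
  obtain ⟨c, hc⟩ := hx
  exact IsIntegral.of_pow hp.pos (hc ▸ isIntegral_algebraMap)

lemma finrank_adjoin_simple_eq_of_pow_mem_range [CharP F p] (hp : p.Prime) {x : F}
    (hx : x ^ p ∈ (algebraMap K F).range) (hxK : x ∉ (algebraMap K F).range) :
    Module.finrank K K⟮x⟯ = p := by
  have := Fact.mk hp
  rw [adjoin.finrank (isIntegral_of_pow_mem_range hp hx)]
  obtain ⟨c, hc⟩ := hx
  have hirr : Irreducible (Polynomial.X ^ p - Polynomial.C c) := by
    refine X_pow_sub_C_irreducible_of_prime hp fun b hb => hxK ⟨b, ?_⟩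
    apply frobenius_inj F p
    simp only [frobenius_def]
    rw [← map_pow, hb, hc]
  rw [← minpoly.eq_of_irreducible_of_monic hirr (by simp [hc])
    (Polynomial.monic_X_pow_sub_C c hp.ne_zero), Polynomial.natDegree_X_pow_sub_C]

lemma finrank_adjoin_simple_le_of_pow_mem_range [CharP F p] (hp : p.Prime) {x : F}
    (hx : x ^ p ∈ (algebraMap K F).range) : Module.finrank K K⟮x⟯ ≤ p := by
  by_cases hxK : x ∈ (algebraMap K F).range
  · have : K⟮x⟯ = ⊥ := adjoin_simple_eq_bot_iff.2 (mem_bot.2 hxK)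
    rw [this, IntermediateField.finrank_bot]
    exact hp.one_le
  · exact (finrank_adjoin_simple_eq_of_pow_mem_range hp hx hxK).le

lemma finrank_adjoin_insert (x : F) (C : Set F) :
    Module.finrank K (adjoin K (insert x C)) =
      Module.finrank K (adjoin K C) * Module.finrank (adjoin K C) (adjoin K C)⟮x⟯ := by
  rw [Module.finrank_mul_finrank, Set.insert_eq, Set.union_comm, ← adjoin_adjoin_left]
  rfl

lemma pow_mem_range_intermediateField (hK : ∀ x : F, x ^ p ∈ (algebraMap K F).range)
    (L : IntermediateField K F) (x : F) : x ^ p ∈ (algebraMap L F).range := by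
  obtain ⟨c, hc⟩ := hK x
  exact ⟨algebraMap K L c, hc⟩

lemma finrank_adjoin_finset_le [CharP F p] (hp : p.Prime)
    (hK : ∀ x : F, x ^ p ∈ (algebraMap K F).range) (C : Finset F) :
    Module.finrank K (adjoin K (C : Set F)) ≤ p ^ C.card := by
  classical
  induction C using Finset.induction_on with
  | empty =>
    rw [Finset.coe_empty, adjoin_empty, IntermediateField.finrank_bot]
    simp
  | insert x C hx ih =>
    rw [Finset.coe_insert, finrank_adjoin_insert, Finset.card_insert_of_notMem hx, pow_succ]
    exact Nat.mul_le_mul ih (finrank_adjoin_simple_le_of_pow_mem_range hp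
      (pow_mem_range_intermediateField hK _ x))

lemma finrank_adjoin_range_of_notMem_tail [CharP F p] (hp : p.Prime)
    (hK : ∀ x : F, x ^ p ∈ (algebraMap K F).range) {n : ℕ} (b : Fin n → F)
    (hb : ∀ i, b i ∉ adjoin K (b '' (Set.univ \ {i}))) :
    Module.finrank K (adjoin K (Set.range b)) = p ^ n := by
  induction n with
  | zero => simp [Set.range_eq_empty]
  | succ n ih =>
    have hr : Set.range b = insert (b 0) (Set.range fun i : Fin n => b i.succ) := by
      rw [← Fin.cons_self_tail b, Fin.range_cons]
      rfl
    rw [hr, finrank_adjoin_insert, ih, finrank_adjoin_simple_eq_of_pow_mem_range hp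
      (pow_mem_range_intermediateField hK _ _), pow_succ]
    · rintro ⟨y, hy⟩
      have hy' : b 0 ∈ adjoin K (Set.range fun i : Fin n => b i.succ) := by
        rw [← hy]
        exact y.2
      refine hb 0 (adjoin.mono K _ _ ?_ hy')
      rintro _ ⟨i, rfl⟩
      exact ⟨i.succ, by simp, rfl⟩
    · intro i hi
      refine hb i.succ (adjoin.mono K _ _ ?_ hi)
      rintro _ ⟨j, hj, rfl⟩
      exact ⟨j.succ, by simpa using hj, rfl⟩

lemma notMem_adjoin_of_finrank_adjoin_range [CharP F p] (hp : p.Prime)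
    (hK : ∀ x : F, x ^ p ∈ (algebraMap K F).range) {n : ℕ} (b : Fin n → F)
    (hb : Module.finrank K (adjoin K (Set.range b)) = p ^ n) (i : Fin n) :
    b i ∉ adjoin K (b '' (Set.univ \ {i})) := by
  classical
  intro hi
  have hle : adjoin K (Set.range b) ≤ adjoin K (b '' (Set.univ \ {i})) := by
    rw [adjoin_le_iff]
    rintro _ ⟨j, rfl⟩
    by_cases hj : j = i
    · exact hj ▸ hi
    · exact subset_adjoin K _ ⟨j, by simpa using hj, rfl⟩
  have heq := le_antisymm hle (adjoin.mono K _ _ (Set.image_subset_range _ _))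
  have hC : ((Finset.univ.erase i).image b : Set F) = b '' (Set.univ \ {i}) := by
    ext x
    simp
  have hcard : ((Finset.univ.erase i).image b).card ≤ n - 1 := by
    refine Finset.card_image_le.trans ?_
    simp
  have h := finrank_adjoin_finset_le hp hK ((Finset.univ.erase i).image b)
  rw [hC, ← heq, hb] at h
  have := (Nat.pow_le_pow_iff_right hp.one_lt).1 (h.trans (Nat.pow_le_pow_right hp.pos hcard))
  have := i.pos
  omega

end PurelyInseparableExponentOne

section KaehlerDifferentialOfFields

open IntermediateField

lemma exists_maximal_subfield_notMem {F : Type*} [Field F] (L : Subfield F) {a : F}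
    (ha : a ∉ L) : ∃ M : Subfield F, L ≤ M ∧ a ∉ M ∧ ∀ N : Subfield F, M < N → a ∈ N := by
  obtain ⟨M, hLM, hM⟩ := zorn_le_nonempty₀ {M : Subfield F | a ∉ M} (fun c hc hchain y hy => by
    refine ⟨sSup c, fun h => ?_, fun z hz => le_sSup hz⟩
    obtain ⟨s, hs, has⟩ := (Subfield.mem_sSup_of_directedOn ⟨y, hy⟩ hchain.directedOn).1 h
    exact hc hs has) L ha
  exact ⟨M, hLM, hM.prop, fun N hN => by
    by_contra h
    exact hM.not_gt h hN⟩

lemma exists_subfield_D_ne_zero {F : Type*} [Field F] {p : ℕ} [CharP F p] (hp : p.Prime)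
    (L : Subfield F) (hL : ∀ x : F, x ^ p ∈ L) {a : F} (ha : a ∉ L) :
    ∃ M : Subfield F, L ≤ M ∧ KaehlerDifferential.D M F a ≠ 0 := by
  have := Fact.mk hp
  obtain ⟨M, hLM, haM, hmax⟩ := exists_maximal_subfield_notMem L ha
  refine ⟨M, hLM, fun hD => haM ?_⟩
  have hpow : ∀ x : F, x ^ p ∈ (algebraMap M F).range := fun x => ⟨⟨x ^ p, hLM (hL x)⟩, rfl⟩
  have hrange : ∀ x : F, x ∈ (algebraMap M F).range ↔ x ∈ M := fun x =>
    ⟨fun ⟨y, hy⟩ => hy ▸ y.2, fun h => ⟨⟨x, h⟩, rfl⟩⟩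
  have hfin : ∀ x : F, FiniteDimensional M M⟮x⟯ := fun x =>
    adjoin.finiteDimensional (isIntegral_of_pow_mem_range hp (hpow x))
  have htop : M⟮a⟯ = ⊤ := by
    refine eq_top_iff.2 fun b _ => ?_
    by_cases hb : b ∈ M
    · exact M⟮a⟯.algebraMap_mem ⟨b, hb⟩
    have hab : a ∈ M⟮b⟯ := by
      refine hmax M⟮b⟯.toSubfield (lt_of_le_of_ne (fun x hx => M⟮b⟯.algebraMap_mem ⟨x, hx⟩) ?_)
      intro h
      exact hb (h ▸ mem_adjoin_simple_self M b)
    have hle : M⟮a⟯ ≤ M⟮b⟯ := adjoin_simple_le_iff.2 hab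
    have := hfin b
    rw [eq_of_le_of_finrank_eq hle]
    · exact mem_adjoin_simple_self M b
    · rw [finrank_adjoin_simple_eq_of_pow_mem_range hp (hpow a) (by rwa [hrange]),
        finrank_adjoin_simple_eq_of_pow_mem_range hp (hpow b) (by rwa [hrange])]
  have : FiniteDimensional M F := by
    have := hfin a
    rw [htop] at this
    exact Module.Finite.equiv (topEquiv (F := M) (E := F)).toLinearEquiv
  have hDzero : ∀ x : F, KaehlerDifferential.D M F x = 0 := fun x => by
    have hx : x ∈ M⟮a⟯ := htop ▸ mem_top
    induction hx using adjoin_induction with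
    | mem x hx => rw [Set.mem_singleton_iff.1 hx, hD]
    | algebraMap x => simp
    | add x y _ _ hx hy => rw [map_add, hx, hy, add_zero]
    | inv x _ hx => rw [Derivation.leibniz_inv, hx, smul_zero]
    | mul x y _ _ hx hy => rw [Derivation.leibniz, hx, hy, smul_zero, smul_zero, add_zero]
  have : Subsingleton Ω[F⁄M] := by
    rw [← Submodule.subsingleton_iff F, ← subsingleton_iff_bot_eq_top,
      ← KaehlerDifferential.span_range_derivation, eq_comm, Submodule.span_eq_bot]
    rintro _ ⟨x, rfl⟩
    exact hDzero x
  have : Algebra.FormallyUnramified M F := ⟨inferInstance⟩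
  have : Algebra.IsSeparable M F := (Algebra.FormallyUnramified.iff_isSeparable M F).1 inferInstance
  have : IsPurelyInseparable M F :=
    (isPurelyInseparable_iff_pow_mem M p).2 fun x => ⟨1, by simpa using hpow x⟩
  exact (hrange a).1 (IsPurelyInseparable.inseparable M a (Algebra.IsSeparable.isSeparable M a))

/-- The elements of a field whose differential lies in a given subspace of differentials. -/
def subfieldOfDMem {F : Type*} [Field F] (N : Submodule F (Ω[F⁄ℤ])) : Subfield F where
  carrier := {x | KaehlerDifferential.D ℤ F x ∈ N}
  mul_mem' hx hy := by
    rw [Set.mem_ofPred_eq, Derivation.leibniz]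
    exact N.add_mem (N.smul_mem _ hy) (N.smul_mem _ hx)
  one_mem' := by simp
  add_mem' hx hy := by
    rw [Set.mem_ofPred_eq, map_add]
    exact N.add_mem hx hy
  zero_mem' := by simp
  neg_mem' hx := by
    rw [Set.mem_ofPred_eq, map_neg]
    exact N.neg_mem hx
  inv_mem' x hx := by
    rw [Set.mem_ofPred_eq, Derivation.leibniz_inv]
    exact N.smul_mem _ hx

lemma mem_subfieldOfDMem {F : Type*} [Field F] {N : Submodule F (Ω[F⁄ℤ])} {x : F} :
    x ∈ subfieldOfDMem N ↔ KaehlerDifferential.D ℤ F x ∈ N := Iff.rfl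

lemma D_pow_char {F : Type*} [Field F] (p : ℕ) [CharP F p] (x : F) :
    KaehlerDifferential.D ℤ F (x ^ p) = 0 := by
  rw [Derivation.leibniz_pow, ← Nat.cast_smul_eq_nsmul F, CharP.cast_eq_zero, zero_smul]

lemma pow_mem_pClosure {F : Type} [Field F] (p : ℕ) (C : Set F) (x : F) :
    x ^ p ∈ pClosure F p C :=
  Subfield.subset_closure (Or.inl ⟨x, by simp⟩)

lemma subset_pClosure {F : Type} [Field F] (p : ℕ) (C : Set F) : C ⊆ pClosure F p C :=
  fun _ hx => Subfield.subset_closure (Or.inr hx)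

lemma pClosure_le_iff {F : Type} [Field F] {p : ℕ} {C : Set F} {L : Subfield F} :
    pClosure F p C ≤ L ↔ (∀ x : F, x ^ p ∈ L) ∧ C ⊆ L := by
  simp [pClosure, pClosureT, Subfield.closure_le, Set.range_subset_iff]

lemma D_mem_of_mem_pClosure {F : Type} [Field F] {p : ℕ} [CharP F p] {C : Set F}
    {N : Submodule F (Ω[F⁄ℤ])} (hC : ∀ c ∈ C, KaehlerDifferential.D ℤ F c ∈ N) {x : F}
    (hx : x ∈ pClosure F p C) : KaehlerDifferential.D ℤ F x ∈ N :=
  have hle : pClosure F p C ≤ subfieldOfDMem N := pClosure_le_iff.2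
    ⟨fun y => by rw [mem_subfieldOfDMem, D_pow_char]; exact N.zero_mem, fun c hc => hC c hc⟩
  hle hx

lemma mem_adjoin_pClosure_empty {F : Type} [Field F] {p : ℕ} {C : Set F} {x : F} :
    x ∈ adjoin (pClosure F p ∅) C ↔ x ∈ pClosure F p C := by
  constructor
  · intro hx
    have hle : adjoin (pClosure F p ∅) C ≤
        (pClosure F p C).toIntermediateField (K := pClosure F p ∅) (fun c =>
          pClosure_le_iff.2 ⟨pow_mem_pClosure p C, Set.empty_subset _⟩ c.2) :=
      adjoin_le_iff.2 (subset_pClosure p C)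
    exact hle hx
  · intro hx
    have hle : pClosure F p C ≤ (adjoin (pClosure F p ∅) C).toSubfield := pClosure_le_iff.2
      ⟨fun y => (adjoin (pClosure F p ∅) C).algebraMap_mem ⟨y ^ p, pow_mem_pClosure p ∅ y⟩,
        subset_adjoin _ _⟩
    exact hle hx

lemma D_mem_span_iff_mem_pClosure {F : Type} [Field F] {p : ℕ} [CharP F p] (hp : p.Prime)
    {C : Set F} {x : F} :
    KaehlerDifferential.D ℤ F x ∈ Submodule.span F (KaehlerDifferential.D ℤ F '' C) ↔
      x ∈ pClosure F p C := by
  refine ⟨fun h => ?_, D_mem_of_mem_pClosure fun c hc =>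
    Submodule.subset_span (Set.mem_image_of_mem _ hc)⟩
  by_contra hx
  obtain ⟨M, hM, hD⟩ := exists_subfield_D_ne_zero hp _ (pow_mem_pClosure p C) hx
  have hle : Submodule.span F (KaehlerDifferential.D ℤ F '' C) ≤
      LinearMap.ker (KaehlerDifferential.map ℤ M F F) := by
    rw [Submodule.span_le]
    rintro _ ⟨c, hc, rfl⟩
    rw [SetLike.mem_coe, LinearMap.mem_ker, KaehlerDifferential.map_D]
    exact (KaehlerDifferential.D M F).map_algebraMap ⟨c, hM (subset_pClosure p C hc)⟩
  have := hle h
  rw [LinearMap.mem_ker, KaehlerDifferential.map_D] at this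
  exact hD this

lemma pIndep_iff_linearIndependent_D {F : Type} [Field F] {p : ℕ} [CharP F p] (hp : p.Prime)
    {n : ℕ} (b : Fin n → F) :
    pIndep F p b ↔ LinearIndependent F fun i => KaehlerDifferential.D ℤ F (b i) := by
  have hK : ∀ x : F, x ^ p ∈ (algebraMap (pClosure F p ∅) F).range :=
    fun x => ⟨⟨x ^ p, pow_mem_pClosure p ∅ x⟩, rfl⟩
  have hiff : ∀ i, b i ∉ adjoin (pClosure F p ∅) (b '' (Set.univ \ {i})) ↔
      KaehlerDifferential.D ℤ F (b i) ∉
        Submodule.span F ((fun j => KaehlerDifferential.D ℤ F (b j)) '' (Set.univ \ {i})) := by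
    intro i
    rw [mem_adjoin_pClosure_empty, ← D_mem_span_iff_mem_pClosure hp, Set.image_image]
  rw [linearIndependent_iff_notMem_span]
  exact ⟨fun h i => (hiff i).1 (notMem_adjoin_of_finrank_adjoin_range hp hK b h i),
    fun h => finrank_adjoin_range_of_notMem_tail hp hK b fun i => (hiff i).2 (h i)⟩

end KaehlerDifferentialOfFields

namespace ExteriorAlgebra

open CliffordAlgebra (contractLeft)

variable {K V : Type*} [Field K] [AddCommGroup V] [Module K V]

variable (K V) in
/-- The exterior powers, as subspaces of the exterior algebra, indexed by the integers and
zero in negative degrees. -/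
def intPower (n : ℤ) : Submodule K (ExteriorAlgebra K V) :=
  if 0 ≤ n then ⋀[K]^(n.toNat) V else ⊥

lemma intPower_natCast (n : ℕ) : intPower K V n = ⋀[K]^n V := by
  simp [intPower]

lemma intPower_of_neg {n : ℤ} (hn : n < 0) : intPower K V n = ⊥ := by
  simp [intPower, hn]

/-- A homogeneous element is zero or has a natural number as its degree. -/
lemma eq_zero_or_exists_nat {n : ℤ} {x : ExteriorAlgebra K V} (hx : x ∈ intPower K V n) :
    x = 0 ∨ ∃ k : ℕ, n = k ∧ x ∈ ⋀[K]^k V := by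
  rcases lt_or_ge n 0 with hn | hn
  · rw [intPower_of_neg hn] at hx
    exact Or.inl ((Submodule.mem_bot K).1 hx)
  · lift n to ℕ using hn
    exact Or.inr ⟨n, rfl, intPower_natCast (K := K) (V := V) n ▸ hx⟩

lemma ι_mul_mem_intPower {n : ℤ} {x : ExteriorAlgebra K V} (hx : x ∈ intPower K V n) (v : V) :
    ι K v * x ∈ intPower K V (n + 1) := by
  rcases eq_zero_or_exists_nat hx with rfl | ⟨k, rfl, hx⟩
  · simp
  · rw [← Nat.cast_succ, intPower_natCast, exteriorPower, pow_succ']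
    exact Submodule.mul_mem_mul (LinearMap.mem_range_self _ v) hx

lemma prod_ofFn_ι_mul_mem_intPower {k : ℕ} (v : Fin k → V) {n : ℤ} {x : ExteriorAlgebra K V}
    (hx : x ∈ intPower K V n) :
    (List.ofFn fun i => ι K (v i)).prod * x ∈ intPower K V (n + k) := by
  induction k with
  | zero => simpa using hx
  | succ k ih =>
    rw [List.ofFn_succ, List.prod_cons, mul_assoc, Nat.cast_succ, ← add_assoc]
    exact ι_mul_mem_intPower (ih fun i => v i.succ) _

lemma prod_ofFn_ι_mem_intPower {k : ℕ} (v : Fin k → V) :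
    (List.ofFn fun i => ι K (v i)).prod ∈ intPower K V k := by
  have h1 : (1 : ExteriorAlgebra K V) ∈ intPower K V 0 := by simp [intPower]
  simpa using prod_ofFn_ι_mul_mem_intPower v h1

lemma ι_mul_ι_mul (v w : V) (x : ExteriorAlgebra K V) :
    ι K v * (ι K w * x) = -(ι K w * (ι K v * x)) := by
  rw [← mul_assoc, ← mul_assoc, ← neg_mul, eq_neg_of_add_eq_zero_left (ι_add_mul_swap v w)]

/-- Graded commutativity of a homogeneous element with vectors. -/
lemma exists_ι_mul_eq_smul {n : ℤ} {x : ExteriorAlgebra K V} (hx : x ∈ intPower K V n) :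
    ∃ ε : K, ε * ε = 1 ∧ ∀ v, ι K v * x = ε • (x * ι K v) := by
  rcases eq_zero_or_exists_nat hx with rfl | ⟨k, rfl, hk⟩
  · exact ⟨1, by simp⟩
  refine ⟨(-1) ^ k, by rw [← mul_pow]; simp, fun v => ?_⟩
  clear hx
  induction hk using Submodule.pow_induction_on_left' with
  | algebraMap r => simpa using (Algebra.commutes r (ι K v)).symm
  | add x y i hx hy ihx ihy =>
    rw [mul_add, ihx, ihy, add_mul, smul_add]
  | mem_mul m hm i x hx ih =>
    obtain ⟨w, rfl⟩ := hm
    rw [ι_mul_ι_mul, ih, mul_smul_comm, pow_succ', neg_one_mul, neg_smul, mul_assoc]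

lemma exists_mul_ι_eq_smul {n : ℤ} {x : ExteriorAlgebra K V} (hx : x ∈ intPower K V n) :
    ∃ ε : K, ∀ v, x * ι K v = ε • (ι K v * x) := by
  obtain ⟨ε, hε, h⟩ := exists_ι_mul_eq_smul hx
  exact ⟨ε, fun v => by rw [h, smul_smul, hε, one_smul]⟩

lemma contractLeft_mem_intPower (f : Module.Dual K V) {n : ℤ} {x : ExteriorAlgebra K V}
    (hx : x ∈ intPower K V n) : contractLeft f x ∈ intPower K V (n - 1) := by
  rcases eq_zero_or_exists_nat hx with rfl | ⟨k, rfl, hk⟩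
  · simp
  clear hx
  induction hk using Submodule.pow_induction_on_left' with
  | algebraMap r => rw [CliffordAlgebra.contractLeft_algebraMap]; exact Submodule.zero_mem _
  | add x y i hx hy ihx ihy =>
    rw [map_add]
    exact Submodule.add_mem _ ihx ihy
  | mem_mul m hm i x hx ih =>
    obtain ⟨w, rfl⟩ := hm
    have hx' : x ∈ intPower K V i := intPower_natCast (K := K) (V := V) i ▸ hx
    rw [CliffordAlgebra.contractLeft_ι_mul, Nat.cast_succ, add_sub_cancel_right]
    refine Submodule.sub_mem _ (Submodule.smul_mem _ _ hx') ?_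
    simpa using ι_mul_mem_intPower ih w

/-- The forms of degree `n` in the ideal generated by a subspace `P` of vectors. -/
def vectorIdeal (P : Submodule K V) (n : ℤ) : Submodule K (ExteriorAlgebra K V) :=
  P.map (ι K) * intPower K V (n - 1)

lemma ι_mul_mem_vectorIdeal {P : Submodule K V} {v : V} (hv : v ∈ P) {n : ℤ}
    {x : ExteriorAlgebra K V} (hx : x ∈ intPower K V (n - 1)) :
    ι K v * x ∈ vectorIdeal P n :=
  Submodule.mul_mem_mul (Submodule.mem_map_of_mem hv) hx

lemma vectorIdeal_mono {P Q : Submodule K V} (h : P ≤ Q) (n : ℤ) :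
    vectorIdeal P n ≤ vectorIdeal Q n :=
  mul_le_mul_left (Submodule.map_mono h) _

lemma vectorIdeal_le_iff {P : Submodule K V} {n : ℤ} {N : Submodule K (ExteriorAlgebra K V)} :
    vectorIdeal P n ≤ N ↔ ∀ v ∈ P, ∀ x ∈ intPower K V (n - 1), ι K v * x ∈ N := by
  rw [vectorIdeal, Submodule.mul_le]
  exact ⟨fun h v hv => h _ (Submodule.mem_map_of_mem hv), fun h m ⟨v, hv, hm⟩ => hm ▸ h v hv⟩

lemma ι_mul_mem_vectorIdeal_succ {P : Submodule K V} {n : ℤ} {x : ExteriorAlgebra K V}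
    (hx : x ∈ vectorIdeal P n) (v : V) : ι K v * x ∈ vectorIdeal P (n + 1) := by
  have hle : vectorIdeal P n ≤ (vectorIdeal P (n + 1)).comap (LinearMap.mulLeft K (ι K v)) := by
    refine vectorIdeal_le_iff.2 fun w hw y hy => ?_
    rw [Submodule.mem_comap, LinearMap.mulLeft_apply, ι_mul_ι_mul]
    refine Submodule.neg_mem _ (ι_mul_mem_vectorIdeal hw ?_)
    simpa using ι_mul_mem_intPower hy v
  exact hle hx

lemma contractLeft_mem_vectorIdeal {P : Submodule K V} {f : Module.Dual K V}
    (hf : ∀ v ∈ P, f v = 0) {n : ℤ} {x : ExteriorAlgebra K V} (hx : x ∈ vectorIdeal P n) :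
    contractLeft f x ∈ vectorIdeal P (n - 1) := by
  have hle : vectorIdeal P n ≤ (vectorIdeal P (n - 1)).comap (contractLeft f) := by
    refine vectorIdeal_le_iff.2 fun w hw y hy => ?_
    rw [Submodule.mem_comap, CliffordAlgebra.contractLeft_ι_mul, hf w hw, zero_smul, zero_sub]
    exact Submodule.neg_mem _ (ι_mul_mem_vectorIdeal hw (contractLeft_mem_intPower f hy))
  exact hle hx

lemma sub_ι_mul_contractLeft_mem_vectorIdeal {P : Submodule K V} {f : Module.Dual K V}
    (hf : ∀ v ∈ P, f v = 0) {v : V} (hv : f v = 1) {n : ℤ} {x : ExteriorAlgebra K V}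
    (hx : ι K v * x ∈ vectorIdeal P (n + 1)) :
    x - ι K v * contractLeft f x ∈ vectorIdeal P n := by
  have := contractLeft_mem_vectorIdeal hf hx
  rwa [CliffordAlgebra.contractLeft_ι_mul, hv, one_smul, add_sub_cancel_right] at this

lemma mem_vectorIdeal_of_mul_prod_eq_zero {k : ℕ} (v : Fin k → V) (f : Fin k → Module.Dual K V)
    (hf : ∀ i j, f i (v j) = if i = j then 1 else 0) {n : ℤ} {x : ExteriorAlgebra K V}
    (hx : x ∈ intPower K V n) (h : x * (List.ofFn fun i => ι K (v i)).prod = 0) :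
    x ∈ vectorIdeal (Submodule.span K (Set.range v)) n := by
  induction k generalizing n x with
  | zero =>
    have : x = 0 := by simpa using h
    rw [this]
    exact Submodule.zero_mem _
  | succ k ih =>
    obtain ⟨ε, -, hε⟩ := exists_ι_mul_eq_smul hx
    have htail : ι K (v 0) * x ∈
        vectorIdeal (Submodule.span K (Set.range fun i : Fin k => v i.succ)) (n + 1) := by
      refine ih (fun i => v i.succ) (fun i => f i.succ) (fun i j => ?_)
        (ι_mul_mem_intPower hx _) ?_
      · simp [hf]
      · rw [List.ofFn_succ, List.prod_cons, ← mul_assoc] at h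
        rw [hε, smul_mul_assoc, h, smul_zero]
    have hf0 : ∀ w ∈ Submodule.span K (Set.range fun i : Fin k => v i.succ), f 0 w = 0 := by
      intro w hw
      have hle : Submodule.span K (Set.range fun i : Fin k => v i.succ) ≤ LinearMap.ker (f 0) := by
        rw [Submodule.span_le]
        rintro _ ⟨i, rfl⟩
        simp [hf, (Fin.succ_ne_zero i).symm]
      exact hle hw
    have hsub := sub_ι_mul_contractLeft_mem_vectorIdeal hf0 (by simp [hf]) htail
    rw [← sub_add_cancel x (ι K (v 0) * contractLeft (f 0) x)]
    refine Submodule.add_mem _ (vectorIdeal_mono (Submodule.span_mono ?_) n hsub)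
      (ι_mul_mem_vectorIdeal (Submodule.subset_span (Set.mem_range_self 0))
        (contractLeft_mem_intPower _ hx))
    rintro _ ⟨i, rfl⟩
    exact ⟨i.succ, rfl⟩

lemma exists_sub_prod_mul_mem_vectorIdeal {P : Submodule K V} {k : ℕ} (w : Fin k → V)
    (f : Fin k → Module.Dual K V) (hf : ∀ i j, f i (w j) = if i = j then 1 else 0)
    (hP : ∀ i, ∀ v ∈ P, f i v = 0) {n : ℤ} {x : ExteriorAlgebra K V}
    (hx : x ∈ intPower K V n) (h : ∀ j, ι K (w j) * x ∈ vectorIdeal P (n + 1)) :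
    ∃ y ∈ intPower K V (n - k),
      x - (List.ofFn fun i => ι K (w i)).prod * y ∈ vectorIdeal P n := by
  induction k generalizing n x with
  | zero => exact ⟨x, by simpa using hx, by simp⟩
  | succ k ih =>
    obtain ⟨y, hy, hxy⟩ := ih (fun i => w i.succ) (fun i => f i.succ)
      (fun i j => by simp [hf])
      (fun i => hP i.succ) (contractLeft_mem_intPower (f 0) hx) (fun j => by
        have := contractLeft_mem_vectorIdeal (hP 0) (h j.succ)
        rw [CliffordAlgebra.contractLeft_ι_mul, hf, if_neg (Fin.succ_ne_zero j).symm, zero_smul,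
          zero_sub, Submodule.neg_mem_iff] at this
        simpa using this)
    refine ⟨y, by rwa [Nat.cast_succ, add_comm, ← sub_sub], ?_⟩
    have h0 := sub_ι_mul_contractLeft_mem_vectorIdeal (hP 0) (by simp [hf]) (h 0)
    have h1 := ι_mul_mem_vectorIdeal_succ hxy (w 0)
    rw [sub_add_cancel] at h1
    rw [List.ofFn_succ, List.prod_cons, mul_assoc]
    simpa [mul_sub] using Submodule.add_mem _ h0 h1

lemma exists_dual_family {ι' : Type*} [DecidableEq ι'] {u : ι' → V}
    (hu : LinearIndependent K u) :
    ∃ f : ι' → Module.Dual K V, ∀ i j, f i (u j) = if i = j then 1 else 0 := by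
  obtain ⟨g, hg⟩ := LinearMap.exists_leftInverse_of_injective
    (Finsupp.linearCombination K u) (LinearMap.ker_eq_bot.2 hu)
  refine ⟨fun i => Finsupp.lapply i ∘ₗ g, fun i j => ?_⟩
  have := LinearMap.congr_fun hg (Finsupp.single j 1)
  simp only [LinearMap.comp_apply, Finsupp.linearCombination_single, one_smul,
    LinearMap.id_apply] at this
  simp [this, Finsupp.single_apply, eq_comm]

lemma ι_mul_prod_eq_zero_of_mem_span {k : ℕ} (v : Fin k → V) {u : V}
    (hu : u ∈ Submodule.span K (Set.range v)) :
    ι K u * (List.ofFn fun i => ι K (v i)).prod = 0 := by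
  have hle : Submodule.span K (Set.range v) ≤
      LinearMap.ker (LinearMap.mulRight K (List.ofFn fun i => ι K (v i)).prod ∘ₗ ι K) := by
    rw [Submodule.span_le]
    rintro _ ⟨i, rfl⟩
    exact ι_mul_prod_list v i
  exact hle hu

/-- The forms of degree `n` annihilating all products `v₁ ∧ … ∧ vₖ ∧ wⱼ`, for a linearly
independent family of vectors `v₁, …, vₖ, w₁, …, wₗ`. -/
theorem mem_intPower_and_mul_eq_zero_iff {k l : ℕ} (v : Fin k → V) (w : Fin l → V)
    (h : LinearIndependent K (Fin.append v w)) {n : ℤ} {x : ExteriorAlgebra K V} :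
    (x ∈ intPower K V n ∧ ∀ j, x * ((List.ofFn fun i => ι K (v i)).prod * ι K (w j)) = 0) ↔
      x ∈ vectorIdeal (Submodule.span K (Set.range v)) n ⊔
        (intPower K V (n - l)).map
          (LinearMap.mulLeft K (List.ofFn fun i => ι K (w i)).prod) := by
  obtain ⟨εv, hεv⟩ := exists_mul_ι_eq_smul (prod_ofFn_ι_mem_intPower (K := K) v)
  obtain ⟨εv', -, hεv'⟩ := exists_ι_mul_eq_smul (prod_ofFn_ι_mem_intPower (K := K) v)
  obtain ⟨εw, hεw⟩ := exists_mul_ι_eq_smul (prod_ofFn_ι_mem_intPower (K := K) w)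
  constructor
  · rintro ⟨hx, hann⟩
    obtain ⟨f, hf⟩ := exists_dual_family h
    obtain ⟨εx, -, hεx⟩ := exists_ι_mul_eq_smul hx
    obtain ⟨y, hy, hxy⟩ := exists_sub_prod_mul_mem_vectorIdeal
      (P := Submodule.span K (Set.range v)) w (fun j => f (Fin.natAdd k j))
      (fun i j => by simpa using hf (Fin.natAdd k i) (Fin.natAdd k j))
      (fun i u hu => by
        have hle : Submodule.span K (Set.range v) ≤ LinearMap.ker (f (Fin.natAdd k i)) := by
          rw [Submodule.span_le]
          rintro _ ⟨j, rfl⟩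
          have := hf (Fin.natAdd k i) (Fin.castAdd l j)
          rw [Fin.append_left, if_neg (by simp [Fin.ext_iff]; omega)] at this
          exact this
        exact hle hu) hx
      (fun j => by
        refine mem_vectorIdeal_of_mul_prod_eq_zero v (fun i => f (Fin.castAdd l i))
          (fun i j => by simpa using hf (Fin.castAdd l i) (Fin.castAdd l j))
          (ι_mul_mem_intPower hx _) ?_
        rw [hεx, smul_mul_assoc, mul_assoc, hεv', mul_smul_comm, hann, smul_zero, smul_zero])
    rw [← sub_add_cancel x ((List.ofFn fun i => ι K (w i)).prod * y)]
    exact Submodule.add_mem_sup hxy ⟨y, hy, rfl⟩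
  · intro hx
    refine ⟨?_, fun j => ?_⟩
    · refine sup_le (vectorIdeal_le_iff.2 fun u _ y hy => ?_) ?_ hx
      · simpa using ι_mul_mem_intPower hy u
      · rintro _ ⟨y, hy, rfl⟩
        simpa using prod_ofFn_ι_mul_mem_intPower w hy
    · rw [← LinearMap.mulRight_apply (R := K), ← LinearMap.mem_ker]
      refine sup_le (vectorIdeal_le_iff.2 fun u hu y hy => ?_) ?_ hx
      · obtain ⟨ε, -, hε⟩ := exists_ι_mul_eq_smul hy
        rw [LinearMap.mem_ker, LinearMap.mulRight_apply, hε, smul_mul_assoc, mul_assoc,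
          ← mul_assoc (ι K u), ι_mul_prod_eq_zero_of_mem_span v hu, zero_mul, mul_zero, smul_zero]
      · rintro _ ⟨y, hy, rfl⟩
        obtain ⟨ε, hε⟩ := exists_mul_ι_eq_smul hy
        rw [LinearMap.mem_ker, LinearMap.mulRight_apply, LinearMap.mulLeft_apply, hεv,
          mul_smul_comm, mul_assoc, ← mul_assoc y, hε, smul_mul_assoc, mul_smul_comm, mul_assoc,
          ← mul_assoc _ (ι K (w j)), hεw, ι_mul_prod_list, smul_zero, zero_mul, smul_zero,
          smul_zero]

end ExteriorAlgebra

section AnnihilatorOfProductSets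

open KaehlerDifferential

variable {F : Type} [Field F]

lemma OmegaPow_eq_intPower (n : ℤ) : OmegaPow F n = ExteriorAlgebra.intPower F (Ω[F⁄ℤ]) n := rfl

lemma dwedge_eq_ιMulti {n : ℕ} (a : Fin n → F) :
    dwedge F a = ExteriorAlgebra.ιMulti F n fun i => D ℤ F (a i) := by
  rw [ExteriorAlgebra.ιMulti_apply]
  rfl

lemma dwedge_succ {n : ℕ} (s : Fin (n + 1) → F) :
    dwedge F s = dwedge F (fun i => s i.castSucc) * dform F (s (Fin.last n)) := by
  rw [dwedge, List.ofFn_succ', List.prod_concat]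
  rfl

lemma linearIndependent_D_of_dwedge_ne_zero {n : ℕ} {a : Fin n → F} (h : dwedge F a ≠ 0) :
    LinearIndependent F fun i => D ℤ F (a i) := by
  by_contra hli
  exact h (by rw [dwedge_eq_ιMulti, AlternatingMap.map_linearDependent _ _ hli])

lemma dwedge_eq_prod_smul {n : ℕ} {s a c : Fin n → F}
    (h : ∀ i, D ℤ F (s i) = c i • D ℤ F (a i)) : dwedge F s = (∏ i, c i) • dwedge F a := by
  rw [dwedge_eq_ιMulti, dwedge_eq_ιMulti, ← AlternatingMap.map_smul_univ]
  exact congrArg _ (funext h)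

lemma iSup_wedgeL_dform_eq_vectorIdeal {r : ℕ} (a : Fin r → F) (n : ℤ) :
    ⨆ i, wedgeL F (dform F (a i)) (OmegaPow F (n - 1)) =
      ExteriorAlgebra.vectorIdeal
        (Submodule.span F (Set.range fun i => D ℤ F (a i))) n := by
  rw [ExteriorAlgebra.vectorIdeal, Submodule.span_range_eq_iSup, Submodule.map_iSup,
    Submodule.iSup_mul]
  refine iSup_congr fun i => ?_
  rw [Submodule.map_span, Set.image_singleton]
  ext x
  rw [Submodule.mem_span_singleton_mul]
  rfl

lemma exists_D_eq_smul_of_mem_pClosure {p : ℕ} [CharP F p] {a x : F}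
    (hx : x ∈ pClosure F p {a}) : ∃ c : F, D ℤ F x = c • D ℤ F a := by
  have h : D ℤ F x ∈ Submodule.span F {D ℤ F a} := D_mem_of_mem_pClosure
    (fun c hc => Set.mem_singleton_iff.1 hc ▸ Submodule.mem_span_singleton_self _) hx
  obtain ⟨c, hc⟩ := Submodule.mem_span_singleton.1 h
  exact ⟨c, hc.symm⟩

lemma exists_mem_D_eq_smul {p : ℕ} [CharP F p] {a : F} {S : Set F}
    (hS : pClosure F p S = pClosure F p {a}) (ha : D ℤ F a ≠ 0) :
    ∃ s ∈ S, ∃ c : F, c ≠ 0 ∧ D ℤ F s = c • D ℤ F a := by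
  by_contra! h
  have hzero : ∀ s ∈ S, D ℤ F s ∈ (⊥ : Submodule F (Ω[F⁄ℤ])) := fun s hs => by
    obtain ⟨c, hc⟩ := exists_D_eq_smul_of_mem_pClosure (hS ▸ subset_pClosure p S hs)
    by_cases hc0 : c = 0
    · simp [hc, hc0]
    · exact absurd hc (h s hs c hc0)
  exact ha ((Submodule.mem_bot F).1
    (D_mem_of_mem_pClosure hzero (hS ▸ subset_pClosure p {a} rfl)))

/-- A form annihilates `dS₁ ∧ … ∧ dSᵣ₊₁` if and only if it annihilates all the products
`d a₁ ∧ … ∧ d aᵣ ∧ d eⱼ`. -/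
lemma forall_mem_dSet_mul_eq_zero_iff {p r l : ℕ} [CharP F p] {S : Fin (r + 1) → Set F}
    {a : Fin r → F} {e : Fin l → F} (ha : ∀ i, D ℤ F (a i) ≠ 0)
    (hSa : ∀ i : Fin r, pClosure F p (S i.castSucc) = pClosure F p {a i})
    (hSe : pClosure F p (Set.range a ∪ S (Fin.last r)) =
      pClosure F p (Set.range a ∪ Set.range e)) (ω : ExtOmega F) :
    (∀ u ∈ dSet F S, ω * u = 0) ↔ ∀ j, ω * (dwedge F a * dform F (e j)) = 0 := by
  let N : Submodule F (Ω[F⁄ℤ]) :=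
    LinearMap.ker (LinearMap.mulLeft F (ω * dwedge F a) ∘ₗ ExteriorAlgebra.ι F)
  have hN : ∀ x : F, D ℤ F x ∈ N ↔ ω * (dwedge F a * dform F x) = 0 := fun x => by
    rw [← mul_assoc]
    rfl
  have haN : ∀ x ∈ Set.range a, D ℤ F x ∈ N := by
    rintro _ ⟨i, rfl⟩
    have h0 : dwedge F a * dform F (a i) = 0 := by
      obtain ⟨ε, hε⟩ := ExteriorAlgebra.exists_mul_ι_eq_smul
        (ExteriorAlgebra.prod_ofFn_ι_mem_intPower (K := F) fun i => D ℤ F (a i))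
      have := hε (D ℤ F (a i))
      rw [ExteriorAlgebra.ι_mul_prod_list (fun i => D ℤ F (a i)) i, smul_zero] at this
      exact this
    rw [hN, h0, mul_zero]
  have hmem : ∀ {B C : Set F}, pClosure F p (Set.range a ∪ B) = pClosure F p (Set.range a ∪ C) →
      (∀ x ∈ B, D ℤ F x ∈ N) → ∀ x ∈ C, D ℤ F x ∈ N := by
    intro B C h hB x hx
    have hxC : x ∈ pClosure F p (Set.range a ∪ C) := subset_pClosure p _ (Or.inr hx)
    rw [← h] at hxC
    exact D_mem_of_mem_pClosure (fun c hc => hc.elim (haN c) (hB c)) hxC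
  constructor
  · intro h j
    choose s hsS c hc hsc using fun i => exists_mem_D_eq_smul (hSa i) (ha i)
    refine (hN _).1 (hmem hSe (fun x hx => (hN x).2 ?_) _ ⟨j, rfl⟩)
    have hu := h _ ⟨Fin.snoc s x, fun i => ?_, rfl⟩
    · rw [dwedge_succ] at hu
      simp only [Fin.snoc_castSucc, Fin.snoc_last] at hu
      rw [dwedge_eq_prod_smul hsc, smul_mul_assoc, mul_smul_comm] at hu
      exact (smul_eq_zero.1 hu).resolve_left (Finset.prod_ne_zero_iff.2 fun i _ => hc i)
    · induction i using Fin.lastCases with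
      | last => simpa using hx
      | cast i => simpa using hsS i
  · rintro h _ ⟨s, hs, rfl⟩
    choose c hc using fun i : Fin r => exists_D_eq_smul_of_mem_pClosure
      (hSa i ▸ subset_pClosure p _ (hs i.castSucc))
    have hlast := hmem hSe.symm (by rintro _ ⟨j, rfl⟩; exact (hN _).2 (h j)) _ (hs (Fin.last r))
    rw [dwedge_succ, dwedge_eq_prod_smul hc, smul_mul_assoc, mul_smul_comm, (hN _).1 hlast,
      smul_zero]

lemma le_of_pDegEq_iUnion {p : ℕ} [CharP F p] (hp : p.Prime) {k m : ℕ} {S : Fin k → Set F}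
    {s : Fin k → F} (hs : ∀ i, s i ∈ S i) (hne : dwedge F s ≠ 0)
    (hm : pDegEq F p (⋃ i, S i) m) : k ≤ m := by
  have hk : pDegEq F p (Set.range s) k :=
    (pIndep_iff_linearIndependent_D hp s).2 (linearIndependent_D_of_dwedge_ne_zero hne)
  rw [pDegEq, relDeg] at hk hm
  have : FiniteDimensional (pClosure F p ∅)
      (IntermediateField.adjoin (pClosure F p ∅) (⋃ i, S i)) :=
    Module.finite_of_finrank_pos (hm ▸ pow_pos hp.pos m)
  have hle := IntermediateField.finrank_le_of_le_right (IntermediateField.adjoin.mono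
    (pClosure F p ∅) (Set.range s) (⋃ i, S i) (by
      rintro _ ⟨i, rfl⟩
      exact Set.mem_iUnion.2 ⟨i, hs i⟩))
  rw [hk, hm] at hle
  exact (Nat.pow_le_pow_iff_right hp.one_lt).1 hle

end AnnihilatorOfProductSets

/-- Proposition 3.6. Let `S₁, …, S_{r+1} ⊆ F` be nonempty with
`pdeg Sᵢ = 1` for `i ≤ r` and `dS₁ ∧ … ∧ dS_{r+1} ≠ {0}`, and let
`pdeg(S₁ ∪ … ∪ S_{r+1}) = r + ℓ`. Then `ℓ ≥ 1` and for all `p`-independent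
`a₁, …, a_r, e₁, …, e_ℓ` with `F^p(Sᵢ) = F^p(aᵢ)` and
`F^p(a₁,…,a_r)(S_{r+1}) = F^p(a₁,…,a_r)(e₁,…,e_ℓ)`:
`annΩ^n_F(dS₁ ∧ … ∧ dS_{r+1}) = Σᵢ d aᵢ ∧ Ω^{n−1}(F) + d e₁ ∧ … ∧ d e_ℓ ∧ Ω^{n−ℓ}(F)`. -/
theorem stmt9 (F : Type) [Field F] (p : ℕ) [Fact p.Prime] [CharP F p]
    (n r m : ℕ) (S : Fin (r + 1) → Set F) (hS : ∀ i, (S i).Nonempty)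
    (hdeg1 : ∀ i : Fin r, pDegEq F p (S i.castSucc) 1)
    (hne : dSet F S ≠ {0})
    (hm : pDegEq F p (⋃ i, S i) m) :
    r + 1 ≤ m ∧
      ∀ (a : Fin r → F) (e : Fin (m - r) → F),
        pIndep F p (Fin.append a e) →
        (∀ i : Fin r, pClosure F p (S i.castSucc) = pClosure F p {a i}) →
        pClosure F p (Set.range a ∪ S (Fin.last r)) =
          pClosure F p (Set.range a ∪ Set.range e) →
        annOmega F n (dSet F S) =
          (⨆ i, wedgeL F (dform F (a i)) (OmegaPow F ((n : ℤ) - 1))) ⊔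
            wedgeL F (dwedge F e) (OmegaPow F ((n : ℤ) - (m - r))) := by
  have hp : p.Prime := Fact.out
  have hle : r + 1 ≤ m := by
    have hex : ∃ u ∈ dSet F S, u ≠ 0 := by
      by_contra! h
      choose s hs using hS
      exact hne (Set.eq_singleton_iff_nonempty_unique_mem.2 ⟨⟨_, s, hs, rfl⟩, h⟩)
    obtain ⟨_, ⟨s, hs, rfl⟩, hs0⟩ := hex
    exact le_of_pDegEq_iUnion hp hs hs0 hm
  refine ⟨hle, fun a e hae hSa hSe => ?_⟩
  have hli := (pIndep_iff_linearIndependent_D hp _).1 hae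
  have happ : (fun i => KaehlerDifferential.D ℤ F (Fin.append a e i)) =
      Fin.append (fun i => KaehlerDifferential.D ℤ F (a i))
        (fun j => KaehlerDifferential.D ℤ F (e j)) := by
    funext i
    induction i using Fin.addCases <;> simp
  have ha : ∀ i, KaehlerDifferential.D ℤ F (a i) ≠ 0 := fun i => by
    simpa using hli.ne_zero (Fin.castAdd (m - r) i)
  rw [happ] at hli
  ext ω
  have hcast : (n : ℤ) - (m - r) = n - ((m - r : ℕ) : ℤ) := by
    rw [Nat.cast_sub (by omega)]
  rw [iSup_wedgeL_dform_eq_vectorIdeal, hcast]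
  refine Iff.trans ?_ (ExteriorAlgebra.mem_intPower_and_mul_eq_zero_iff _ _ hli)
  rw [annOmega, Submodule.mem_inf, OmegaPow_eq_intPower]
  refine and_congr Iff.rfl (Iff.trans ?_ (forall_mem_dSet_mul_eq_zero_iff ha hSa hSe ω))
  simp
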